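/- Let y ∈ ℝ^n, X ∈ ℝ^{n×m}, Z ∈ ℝ^{n×k}, and suppose M_Z (y X) has full column rank m+1. Write u = y − Xβ. Then the (m+1)×(m+1) matrix n·Ω̂(β) := [[u^T u, u^T V],[V^T u, V^T V]], where V is chosen to minimize the Gaussian log-likelihood of the reduced-form model, satisfies det(n Ω̂(β)) = (1 + u^T P_Z u / u^T M_Z u) · det((y X)^T M_Z (y X)). Consequently the profiled Gaussian log-likelihood is a strictly decreasing function of the Anderson–Rubin ratio u^T P_Z u / u^T M_Z u. -/

import Mathlib

open Matrix

lemma aux_one_le_det {p : Type*} [Fintype p] [DecidableEq p] {S : Matrix p p ℝ}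
    (hS : S.PosSemidef) : 1 ≤ (1 + S).det := by
  have h1 := Matrix.eval_charpoly S (-1)
  rw [hS.isHermitian.charpoly_eq, Polynomial.eval_prod] at h1
  have h2 : (scalar p) (-1 : ℝ) - S = -(1 + S) := by
    rw [map_neg, map_one]; abel
  rw [h2, Matrix.det_neg] at h1
  have h3 : ∏ i, (Polynomial.X - Polynomial.C (hS.isHermitian.eigenvalues i)).eval (-1 : ℝ)
      = (-1) ^ Fintype.card p * ∏ i, (1 + hS.isHermitian.eigenvalues i) := by
    rw [← Finset.card_univ, ← Finset.prod_const, ← Finset.prod_mul_distrib]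
    refine Finset.prod_congr rfl fun i _ => ?_
    simp; ring
  have h4 : (1 + S).det = ∏ i, (1 + hS.isHermitian.eigenvalues i) := by
    have h5 := h1.symm.trans h3
    exact mul_left_cancel₀ (pow_ne_zero _ (by norm_num)) h5
  rw [h4]
  have h6 : ∏ _i : p, (1 : ℝ) ≤ ∏ i, (1 + hS.isHermitian.eigenvalues i) :=
    Finset.prod_le_prod (fun _ _ => zero_le_one)
      (fun i _ => by linarith [hS.eigenvalues_nonneg i])
  simpa using h6

lemma aux_det_mono {p q : Type*} [Fintype p] [DecidableEq p] [Fintype q] [DecidableEq q]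
    {A : Matrix p p ℝ} (hA : A.PosDef) (E : Matrix q p ℝ) : A.det ≤ (A + Eᵀ * E).det := by
  have hu : IsUnit A.det := (Matrix.isUnit_iff_isUnit_det _).1 hA.isUnit
  have h1 : A + Eᵀ * E = A * (1 + (A⁻¹ * Eᵀ) * E) := by
    rw [Matrix.mul_add, Matrix.mul_one, Matrix.mul_assoc, Matrix.mul_nonsing_inv_cancel_left _ _ hu]
  have hS : (E * (A⁻¹ * Eᵀ)).PosSemidef := by
    have := hA.inv.posSemidef.mul_mul_conjTranspose_same E
    rwa [Matrix.conjTranspose_eq_transpose_of_trivial, Matrix.mul_assoc] at this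
  rw [h1, Matrix.det_mul, Matrix.det_one_add_mul_comm]
  have := aux_one_le_det hS
  have := hA.det_pos
  nlinarith

lemma aux_unit (A : Matrix Unit Unit ℝ) : A = (A () ()) • (1 : Matrix Unit Unit ℝ) := by
  ext i j; simp

lemma aux_schur {n m : ℕ} (S : Matrix (Fin n) (Fin n) ℝ)
    (U : Matrix (Fin n) Unit ℝ) (V : Matrix (Fin n) (Fin m) ℝ) (c : ℝ) (hc : c ≠ 0)
    (hU : Uᵀ * S * U = c • 1) :
    ((fromCols U V)ᵀ * S * fromCols U V).det
      = c * (Vᵀ * (S - c⁻¹ • (S * U * Uᵀ * S)) * V).det := by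
  rw [transpose_fromCols, fromRows_mul, fromRows_mul_fromCols, hU]
  let _ : Invertible (c • (1 : Matrix Unit Unit ℝ)) :=
    ⟨c⁻¹ • 1, by simp [smul_smul, hc], by simp [smul_smul, hc]⟩
  have hi : ⅟(c • (1 : Matrix Unit Unit ℝ)) = c⁻¹ • 1 := rfl
  rw [det_fromBlocks₁₁, hi]
  congr 1
  · simp
  · congr 1
    simp only [Matrix.mul_sub, Matrix.sub_mul, Matrix.mul_smul, Matrix.smul_mul, Matrix.mul_one,
      Matrix.mul_assoc]

lemma aux_dot {n : ℕ} (S : Matrix (Fin n) (Fin n) ℝ) (u : Fin n → ℝ) :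
    (replicateCol Unit u)ᵀ * S * replicateCol Unit u = (u ⬝ᵥ S *ᵥ u) • 1 := by
  rw [Matrix.mul_assoc]
  ext i j
  simp [Matrix.mul_apply, dotProduct, mulVec]

/-- the key determinant facts -/
lemma aux_core {n m k : ℕ} (X : Matrix (Fin n) (Fin m) ℝ) (Z : Matrix (Fin n) (Fin k) ℝ)
    (P : Matrix (Fin n) (Fin n) ℝ) (U : Matrix (Fin n) Unit ℝ)
    (hPsymm : Pᵀ = P) (hPidem : P * P = P) (hPZ : P * Z = Z)
    (hPrange : ∃ C : Matrix (Fin k) (Fin n) ℝ, P = Z * C)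
    (s c : ℝ) (hs : 0 < s) (hc : 0 < c)
    (hsU : Uᵀ * (1 - P) * U = s • 1) (hcU : Uᵀ * U = c • 1)
    (hD : 0 < ((fromCols U X)ᵀ * (1 - P) * fromCols U X).det) :
    (∀ Pi : Matrix (Fin k) (Fin m) ℝ,
      c / s * ((fromCols U X)ᵀ * (1 - P) * fromCols U X).det
        ≤ ((fromCols U (X - Z * Pi))ᵀ * fromCols U (X - Z * Pi)).det) ∧
    (∃ Pi : Matrix (Fin k) (Fin m) ℝ,
      ((fromCols U (X - Z * Pi))ᵀ * fromCols U (X - Z * Pi)).det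
       = c / s * ((fromCols U X)ᵀ * (1 - P) * fromCols U X).det) := by
  have hN : ∀ V : Matrix (Fin n) (Fin m) ℝ, ((fromCols U V)ᵀ * fromCols U V).det
      = c * (Vᵀ * (1 - c⁻¹ • (U * Uᵀ)) * V).det := by
    intro V
    have := aux_schur 1 U V c hc.ne' (by rwa [Matrix.mul_one])
    simpa only [Matrix.mul_one, Matrix.one_mul] using this
  have hDD := aux_schur (1 - P) U X s hs.ne' hsU
  set M := 1 - P with hM
  have hMt : Mᵀ = M := by rw [hM, transpose_sub, transpose_one, hPsymm]
  have hMM : M * M = M := by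
    simp [hM, Matrix.mul_sub, Matrix.sub_mul, hPidem]
  have hMZ : M * Z = 0 := by rw [hM, Matrix.sub_mul, hPZ]; simp
  set Q := M - s⁻¹ • (M * U * Uᵀ * M) with hQ
  set F := c⁻¹ • (U * Uᵀ) with hF
  have hQt : Qᵀ = Q := by
    simp [hQ, Matrix.transpose_sub, Matrix.transpose_mul, hMt, Matrix.mul_assoc]
  have hFt : Fᵀ = F := by simp [hF]
  have hQZ : Q * Z = 0 := by
    simp [hQ, Matrix.sub_mul, Matrix.mul_assoc, hMZ]
  have hQU : Q * U = 0 := by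
    have h1 : M * U * Uᵀ * M * U = s • (M * U) := by
      rw [show M * U * Uᵀ * M * U = M * U * (Uᵀ * M * U) by simp only [Matrix.mul_assoc], hsU]
      simp
    rw [hQ, Matrix.sub_mul, Matrix.smul_mul, h1, smul_smul, inv_mul_cancel₀ hs.ne', one_smul,
      sub_self]
  have hQM : Q * M = Q := by
    simp [hQ, Matrix.sub_mul, Matrix.mul_assoc, hMM]
  have hQQ : Q * Q = Q := by
    conv_lhs => rw [hQ]
    rw [← hQ]
    conv_lhs => enter [2]; rw [hQ]
    rw [Matrix.mul_sub, hQM, Matrix.mul_smul, ← Matrix.mul_assoc, ← Matrix.mul_assoc,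
      ← Matrix.mul_assoc, hQM, hQU]
    simp
  have hFU : F * U = U := by
    rw [hF, Matrix.smul_mul, Matrix.mul_assoc, hcU]
    simp [smul_smul, hc.ne']
  have hFF : F * F = F := by
    conv_lhs => enter [2]; rw [hF]
    rw [Matrix.mul_smul, ← Matrix.mul_assoc, hFU]
  have hQF : Q * F = 0 := by
    rw [hF, Matrix.mul_smul, ← Matrix.mul_assoc, hQU]; simp
  have hFQ : F * Q = 0 := by
    have := congrArg transpose hQF
    rwa [transpose_mul, hQt, hFt, transpose_zero] at this
  set K := 1 - F - Q with hK
  have hKt : Kᵀ = K := by simp [hK, hFt, hQt]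
  have hKK : K * K = K := by
    simp only [hK, Matrix.mul_sub, Matrix.sub_mul, hFF, hQQ, hQF, hFQ, Matrix.one_mul,
      Matrix.mul_one]
    abel
  have hVQ : ∀ Pi : Matrix (Fin k) (Fin m) ℝ,
      (X - Z * Pi)ᵀ * Q * (X - Z * Pi) = Xᵀ * Q * X := by
    intro Pi
    have h1 : Q * (X - Z * Pi) = Q * X := by
      rw [Matrix.mul_sub, ← Matrix.mul_assoc, hQZ]; simp
    have h2 : (X - Z * Pi)ᵀ * Q = Xᵀ * Q := by
      have := congrArg transpose h1
      rwa [transpose_mul, transpose_mul, hQt] at this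
    rw [h2, Matrix.mul_assoc, h1, Matrix.mul_assoc]
  have hsplit : ∀ Pi : Matrix (Fin k) (Fin m) ℝ,
      (X - Z * Pi)ᵀ * (1 - F) * (X - Z * Pi)
        = Xᵀ * Q * X + (K * (X - Z * Pi))ᵀ * (K * (X - Z * Pi)) := by
    intro Pi
    rw [← hVQ Pi, transpose_mul, hKt]
    rw [show (X - Z * Pi)ᵀ * K * (K * (X - Z * Pi)) = (X - Z * Pi)ᵀ * (K * K) * (X - Z * Pi) by
      simp only [Matrix.mul_assoc], hKK, ← Matrix.add_mul, ← Matrix.mul_add, hK]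
    congr 2
    abel
  have hA0 : 0 < (Xᵀ * Q * X).det := by
    rw [hDD] at hD
    exact (mul_pos_iff_of_pos_left hs).1 hD
  have hA : (Xᵀ * Q * X).PosDef := by
    have h1 : (Xᵀ * Q * X) = (Q * X)ᴴ * (Q * X) := by
      rw [conjTranspose_eq_transpose_of_trivial, transpose_mul, hQt]
      rw [show Xᵀ * Q * (Q * X) = Xᵀ * (Q * Q) * X by simp only [Matrix.mul_assoc], hQQ]
    have h2 : (Xᵀ * Q * X).PosSemidef := by
      rw [h1]; exact posSemidef_conjTranspose_mul_self _
    exact h2.posDef_iff_det_ne_zero.2 hA0.ne'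
  have hval : c / s * ((fromCols U X)ᵀ * M * fromCols U X).det = c * (Xᵀ * Q * X).det := by
    rw [hDD]; field_simp
  rw [hval]
  constructor
  · intro Pi
    rw [hN, hsplit]
    exact mul_le_mul_of_nonneg_left (aux_det_mono hA _) hc.le
  · obtain ⟨C, hC⟩ := hPrange
    refine ⟨C * (X - s⁻¹ • (U * (Uᵀ * M * X))), ?_⟩
    rw [hN, hsplit]
    have hV : X - Z * (C * (X - s⁻¹ • (U * (Uᵀ * M * X))))
        = Q * X + U * (s⁻¹ • (Uᵀ * M * X)) := by
      rw [← Matrix.mul_assoc, ← hC, hQ]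
      have hP : P = 1 - M := by rw [hM]; abel
      rw [hP]
      simp only [Matrix.mul_sub, Matrix.sub_mul, Matrix.mul_smul, Matrix.smul_mul, Matrix.one_mul,
        Matrix.mul_assoc, smul_sub]
      abel
    have hKQ : K * Q = 0 := by
      rw [hK, Matrix.sub_mul, Matrix.sub_mul, hQQ, hFQ]; simp
    have hKU : K * U = 0 := by
      rw [hK, Matrix.sub_mul, Matrix.sub_mul, hQU, hFU]; simp
    rw [hV, Matrix.mul_add, ← Matrix.mul_assoc, ← Matrix.mul_assoc, hKQ, hKU]
    simp


lemma aux_trace {n : ℕ} {p : Type*} [Fintype p] [DecidableEq p] (R : Matrix (Fin n) p ℝ)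
    (A : Matrix p p ℝ) : ∑ i, R i ⬝ᵥ A *ᵥ R i = (A * (Rᵀ * R)).trace := by
  rw [← Matrix.mul_assoc, Matrix.trace_mul_comm, ← Matrix.mul_assoc, Matrix.trace]
  refine Finset.sum_congr rfl fun i _ => ?_
  rw [dotProduct_mulVec]
  simp [Matrix.mul_apply, dotProduct, vecMul]

/-- with `u = y − Xβ` and `V = X − ZΠ̂` the likelihood-maximizing residual
matrix, the matrix `nΩ̂(β) = [[uᵀu, uᵀV],[Vᵀu, VᵀV]]` satisfies
`det(nΩ̂(β)) = (1 + uᵀP_Zu/uᵀM_Zu)·det((y X)ᵀ M_Z (y X))`, and consequently the profiled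
Gaussian log-likelihood is a strictly decreasing function of the Anderson–Rubin ratio. -/
theorem stmt_4 {n m k : ℕ} (hn : 0 < n)
    (y : Fin n → ℝ) (X : Matrix (Fin n) (Fin m) ℝ) (Z : Matrix (Fin n) (Fin k) ℝ)
    (P : Matrix (Fin n) (Fin n) ℝ)
    (hPsymm : P.IsSymm) (hPidem : P * P = P) (hPZ : P * Z = Z)
    (hPrange : ∃ C : Matrix (Fin k) (Fin n) ℝ, P = Z * C)
    (β : Fin m → ℝ)
    (u : Fin n → ℝ) (hu : u = y - X *ᵥ β)
    (yX : Matrix (Fin n) (Unit ⊕ Fin m) ℝ)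
    (hyX : yX = Matrix.of fun i => Sum.elim (fun _ => y i) (fun j => X i j))
    (hrank : ((1 - P) * yX).rank = m + 1)
    (resid : Matrix (Fin k) (Fin m) ℝ → Fin n → Unit ⊕ Fin m → ℝ)
    (hresid : resid = fun Pi i =>
      Sum.elim (fun _ => y i - (X *ᵥ β) i) (fun j => X i j - (Z * Pi) i j))
    (ℓ : Matrix (Fin k) (Fin m) ℝ → Matrix (Unit ⊕ Fin m) (Unit ⊕ Fin m) ℝ → ℝ)
    (hℓ : ℓ = fun Pi Ω =>
      -((n : ℝ) * ((m : ℝ) + 1)) / 2 * Real.log (2 * Real.pi)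
        - (n : ℝ) / 2 * Real.log |Ω.det|
        - (1 / 2) * ∑ i, resid Pi i ⬝ᵥ Ω⁻¹ *ᵥ resid Pi i)
    (Pihat : Matrix (Fin k) (Fin m) ℝ)
    (V : Matrix (Fin n) (Fin m) ℝ) (hV : V = X - Z * Pihat)
    (N : Matrix (Unit ⊕ Fin m) (Unit ⊕ Fin m) ℝ)
    (hN : N = Matrix.fromBlocks (Matrix.of fun _ _ => u ⬝ᵥ u)
        (Matrix.of fun _ j => (Vᵀ *ᵥ u) j) (Matrix.of fun j _ => (Vᵀ *ᵥ u) j) (Vᵀ * V))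
    (Ωhat : Matrix (Unit ⊕ Fin m) (Unit ⊕ Fin m) ℝ) (hΩ : Ωhat = (n : ℝ)⁻¹ • N)
    (hopt : ∀ (Pi' : Matrix (Fin k) (Fin m) ℝ)
        (Ω' : Matrix (Unit ⊕ Fin m) (Unit ⊕ Fin m) ℝ),
      Ω'.PosDef → ℓ Pi' Ω' ≤ ℓ Pihat Ωhat)
    (h : ℝ → ℝ)
    (hh : h = fun t =>
      -((n : ℝ) * ((m : ℝ) + 1)) / 2 * Real.log (2 * Real.pi)
        - ((n : ℝ) * ((m : ℝ) + 1)) / 2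
        - (n : ℝ) / 2 * Real.log ((n : ℝ)⁻¹ ^ (m + 1) * (1 + t) * (yXᵀ * (1 - P) * yX).det)) :
    N.det = (1 + (u ⬝ᵥ P *ᵥ u) / (u ⬝ᵥ (1 - P) *ᵥ u)) * (yXᵀ * (1 - P) * yX).det ∧
    StrictAntiOn h (Set.Ioi (-1)) ∧
    ℓ Pihat Ωhat = h ((u ⬝ᵥ P *ᵥ u) / (u ⬝ᵥ (1 - P) *ᵥ u)) := by
  have hn0 : (0 : ℝ) < n := by exact_mod_cast hn
  have hPt : Pᵀ = P := hPsymm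
  have hMt : (1 - P)ᵀ = 1 - P := by rw [transpose_sub, transpose_one, hPt]
  have hMM : (1 - P) * (1 - P) = 1 - P := by
    simp [Matrix.mul_sub, Matrix.sub_mul, hPidem]
  have hGeq : yXᵀ * (1 - P) * yX = ((1 - P) * yX)ᴴ * ((1 - P) * yX) := by
    rw [conjTranspose_eq_transpose_of_trivial, transpose_mul, hMt]
    rw [show yXᵀ * (1 - P) * ((1 - P) * yX) = yXᵀ * ((1 - P) * (1 - P)) * yX by
      simp only [Matrix.mul_assoc], hMM]
  have hG : (yXᵀ * (1 - P) * yX).PosDef := by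
    have h1 : (((1 - P) * yX)ᴴ * ((1 - P) * yX)).PosSemidef := posSemidef_conjTranspose_mul_self _
    rw [hGeq]
    rw [h1.posDef_iff_isUnit]
    have h2 := rank_conjTranspose_mul_self ((1 - P) * yX)
    rw [hrank] at h2
    rw [← mulVec_injective_iff_isUnit]
    have h3 := LinearMap.finrank_range_add_finrank_ker
      (((1 - P) * yX)ᴴ * ((1 - P) * yX)).mulVecLin
    rw [Matrix.rank] at h2
    rw [h2] at h3
    have h4 : Module.finrank ℝ (LinearMap.ker (((1 - P) * yX)ᴴ * ((1 - P) * yX)).mulVecLin) = 0 := by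
      simp at h3; omega
    rw [Submodule.finrank_eq_zero] at h4
    exact LinearMap.ker_eq_bot.1 h4
  have hD0 := hG.det_pos
  set U : Matrix (Fin n) Unit ℝ := replicateCol Unit u with hU
  let T : Matrix (Unit ⊕ Fin m) (Unit ⊕ Fin m) ℝ :=
    fromBlocks 1 0 (-(replicateCol Unit β)) 1
  have hTdet : T.det = 1 := by simp [T]
  have hyX' : yX = fromCols (replicateCol Unit y) X := by
    rw [hyX]; ext i j; rcases j with j | j <;> simp
  have hUX : fromCols U X = yX * T := by
    rw [hyX', fromCols_mul_fromBlocks]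
    congr 1
    · rw [hU, hu]
      ext i j
      simp [Matrix.mul_apply, mulVec, dotProduct, sub_eq_add_neg]
    · simp
  have hGT : (fromCols U X)ᵀ * (1 - P) * fromCols U X = Tᵀ * (yXᵀ * (1 - P) * yX) * T := by
    rw [hUX, transpose_mul]; simp only [Matrix.mul_assoc]
  have hGdet : ((fromCols U X)ᵀ * (1 - P) * fromCols U X).det = (yXᵀ * (1 - P) * yX).det := by
    rw [hGT, det_mul, det_mul, det_transpose, hTdet]; ring
  have hGT' : ((fromCols U X)ᵀ * (1 - P) * fromCols U X).PosDef := by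
    rw [hGT, ← conjTranspose_eq_transpose_of_trivial]
    apply hG.conjTranspose_mul_mul_same
    rw [mulVec_injective_iff_isUnit, isUnit_iff_isUnit_det, hTdet]
    exact isUnit_one
  have hsU := aux_dot (1 - P) u
  have hcU : Uᵀ * U = (u ⬝ᵥ u) • 1 := by
    have := aux_dot 1 u
    simpa only [Matrix.mul_one, one_mulVec] using this
  rw [← hU] at hsU
  have hs : 0 < u ⬝ᵥ (1 - P) *ᵥ u := by
    have h1 := hGT'.diag_pos (i := Sum.inl ())
    rw [transpose_fromCols, fromRows_mul, fromRows_mul_fromCols, fromBlocks_apply₁₁, hsU] at h1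
    simpa using h1
  set s := u ⬝ᵥ (1 - P) *ᵥ u with hsdef
  have hcs : u ⬝ᵥ u = s + u ⬝ᵥ P *ᵥ u := by
    rw [hsdef, sub_mulVec, one_mulVec, dotProduct_sub]; ring
  have hc : 0 < u ⬝ᵥ u := by
    rcases (show 0 ≤ u ⬝ᵥ u from Finset.sum_nonneg fun i _ => mul_self_nonneg _).lt_or_eq
      with h1 | h1
    · exact h1
    · exfalso
      have h2 : u = 0 := dotProduct_self_eq_zero.1 h1.symm
      rw [hsdef, h2] at hs
      simp at hs
  have hratio : (u ⬝ᵥ u) / s = 1 + (u ⬝ᵥ P *ᵥ u) / s := by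
    rw [hcs]; field_simp
  obtain ⟨hlow, Pi0, hPi0⟩ := aux_core X Z P U hPt hPidem hPZ hPrange s (u ⬝ᵥ u) hs hc hsU hcU
    hGT'.det_pos
  rw [hGdet] at hlow hPi0
  rw [hratio] at hlow hPi0
  have hpos : 0 < (1 + (u ⬝ᵥ P *ᵥ u) / s) * (yXᵀ * (1 - P) * yX).det := by
    rw [← hratio]; positivity
  have hres : ∀ Pi i, resid Pi i = fromCols U (X - Z * Pi) i := by
    intro Pi i
    rw [hresid]
    ext j
    rcases j with j | j <;> simp [hU, hu]
  have hNeq : N = (fromCols U (X - Z * Pihat))ᵀ * fromCols U (X - Z * Pihat) := by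
    rw [transpose_fromCols, fromRows_mul_fromCols, hN, ← hV, hcU]
    congr 1
    all_goals
      ext i j
      simp [hU, Matrix.mul_apply, mulVec, dotProduct, mul_comm]
  have hpd : ∀ Pi : Matrix (Fin k) (Fin m) ℝ, ((fromCols U (X - Z * Pi))ᵀ * fromCols U (X - Z * Pi)).PosDef := by
    intro Pi
    have h1 : ((fromCols U (X - Z * Pi))ᵀ * fromCols U (X - Z * Pi)).PosSemidef := by
      rw [← conjTranspose_eq_transpose_of_trivial]
      exact posSemidef_conjTranspose_mul_self _
    exact h1.posDef_iff_det_ne_zero.2 (hpos.trans_le (hlow Pi)).ne'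
  have hprof : ∀ Pi : Matrix (Fin k) (Fin m) ℝ, ℓ Pi ((n : ℝ)⁻¹ • ((fromCols U (X - Z * Pi))ᵀ * fromCols U (X - Z * Pi)))
      = -((n : ℝ) * ((m : ℝ) + 1)) / 2 * Real.log (2 * Real.pi)
        - ((n : ℝ) * ((m : ℝ) + 1)) / 2
        - (n : ℝ) / 2 * Real.log ((n : ℝ)⁻¹ ^ (m + 1) *
          ((fromCols U (X - Z * Pi))ᵀ * fromCols U (X - Z * Pi)).det) := by
    intro Pi
    have hp := hpd Pi
    rw [hℓ]
    simp only [hres]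
    rw [aux_trace]
    set A := (fromCols U (X - Z * Pi))ᵀ * fromCols U (X - Z * Pi) with hA
    have hAu : IsUnit A.det := (isUnit_iff_isUnit_det _).1 hp.isUnit
    have hinv : ((n : ℝ)⁻¹ • A)⁻¹ = (n : ℝ) • A⁻¹ := by
      apply inv_eq_left_inv
      rw [Matrix.smul_mul, Matrix.mul_smul, smul_smul, nonsing_inv_mul _ hAu,
        mul_inv_cancel₀ hn0.ne', one_smul]
    rw [hinv, Matrix.smul_mul, nonsing_inv_mul _ hAu, trace_smul, trace_one, det_smul]
    have hcard : Fintype.card (Unit ⊕ Fin m) = m + 1 := by simp [add_comm]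
    rw [hcard, abs_of_pos (mul_pos (by positivity) hp.det_pos)]
    simp only [smul_eq_mul]
    push_cast
    ring
  have hkey : N.det = (1 + (u ⬝ᵥ P *ᵥ u) / s) * (yXᵀ * (1 - P) * yX).det := by
    apply le_antisymm
    · have h1 := hopt Pi0 _ ((hpd Pi0).smul (inv_pos.2 hn0))
      rw [hprof, hΩ, hNeq, hprof, hPi0, ← hNeq] at h1
      have hNp : 0 < N.det := by rw [hNeq]; exact (hpd Pihat).det_pos
      have hq : 0 < (n : ℝ)⁻¹ ^ (m + 1) := by positivity
      have h2 : Real.log ((n : ℝ)⁻¹ ^ (m + 1) * N.det) ≤ Real.log ((n : ℝ)⁻¹ ^ (m + 1) *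
          ((1 + (u ⬝ᵥ P *ᵥ u) / s) * (yXᵀ * (1 - P) * yX).det)) := by
        have h3 : (0 : ℝ) < (n : ℝ) / 2 := by positivity
        refine le_of_mul_le_mul_left ?_ h3
        linarith
      rw [Real.log_le_log_iff (by positivity) (mul_pos hq hpos)] at h2
      exact le_of_mul_le_mul_left h2 hq
    · rw [hNeq]; exact hlow Pihat
  refine ⟨hkey, ?_, ?_⟩
  · intro a ha b hb hab
    simp only [Set.mem_Ioi] at ha hb
    rw [hh]
    have hq : 0 < (n : ℝ)⁻¹ ^ (m + 1) := by positivity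
    have ha' : 0 < 1 + a := by linarith
    have h1 : Real.log ((n : ℝ)⁻¹ ^ (m + 1) * (1 + a) * (yXᵀ * (1 - P) * yX).det)
        < Real.log ((n : ℝ)⁻¹ ^ (m + 1) * (1 + b) * (yXᵀ * (1 - P) * yX).det) := by
      apply Real.log_lt_log (by positivity)
      gcongr
    have h3 : (0 : ℝ) < (n : ℝ) / 2 := by positivity
    have := mul_lt_mul_of_pos_left h1 h3
    simp only
    linarith
  · rw [hΩ, hNeq, hprof, ← hNeq, hkey, hh]
    simp only [mul_assoc]
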